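/- (Re-filtration Theorem) Let R be a K-algebra with an (ℕ^n,⪯)-filtration F, where ⪯ is any admissible order on ℕ^n, such that the associated graded algebra G(R) is an iterated Ore extension G(R) = Λ[y_1;σ_1]⋯[y_s;σ_s] over Λ = F_0(R) on homogeneous elements y_1,…,y_s of degrees α_1,…,α_s; assume (a) Λ is left noetherian, (b) for each 1 ≤ i < j ≤ s there is q_{ji} ∈ Λ with y_j y_i = q_{ji} y_i y_j, and (c) each F_α(R) is a finitely generated left Λ-module. Choose lifts x_i ∈ F_{α_i}(R) of the y_i. Then there exists a weight vector w = (w_1,…,w_s) ∈ ℕ^s with all w_i > 0 such that the K-submodules R_n = Σ_{⟨w,γ⟩ ≤ n} Λ x^γ (n ∈ ℕ) form an ℕ-filtration of R satisfying: (1) R_0 = Λ; (2) each R_n is a finitely generated left Λ-module; (3) R_m R_n ⊆ R_{m+n}, ⋃_n R_n = R, and the associated graded ring gr(R) = ⊕_{n≥0} R_n/R_{n−1} is isomorphic to Λ[y_1;σ_1]⋯[y_s;σ_s]; concretely, gr(R) is free as a left Λ-module with basis the classes x̄^γ = x^γ + R_{⟨w,γ⟩−1}, and the elements x̄_i = x_i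 + R_{w_i−1} satisfy x̄_i a = σ_i(a) x̄_i for all a ∈ Λ and x̄_j x̄_i = q_{ji} x̄_i x̄_j for 1 ≤ i < j ≤ s. -/

import Mathlib

open scoped BigOperators

/-- Multi-indices: elements of `ℕ^n`. -/
abbrev MIdx (n : ℕ) := Fin n → ℕ

/-- An admissible order on `ℕ^n`: a total order compatible with addition and having `0` as
least element. -/
structure AdmOrder (n : ℕ) where
  le : MIdx n → MIdx n → Prop
  le_refl : ∀ a, le a a
  le_trans : ∀ {a b c}, le a b → le b c → le a c
  le_antisymm : ∀ {a b}, le a b → le b a → a = b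
  le_total : ∀ a b, le a b ∨ le b a
  add_right : ∀ {a b : MIdx n} (c : MIdx n), le a b → le (a + c) (b + c)
  zero_le : ∀ a, le 0 a

/-- The strict order associated to an admissible order. -/
def AdmOrder.lt {n : ℕ} (o : AdmOrder n) (a b : MIdx n) : Prop :=
  o.le a b ∧ a ≠ b

/-- The ordered standard monomial `x^γ = x₁^{γ₁} ⋯ x_s^{γ_s}`. -/
def smon {R : Type*} [Monoid R] {s : ℕ} (x : Fin s → R) (γ : MIdx s) : R :=
  (List.ofFn fun i => x i ^ γ i).prod

/-- A `K`-algebra `R` with an `(ℕ^n,⪯)`-filtration `F` whose associated graded algebra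
`G(R)` is an iterated Ore extension `Λ[y₁;σ₁]⋯[y_s;σ_s]` over `Λ = F₀(R)` on homogeneous
elements `y_i` of degree `deg i`, together with chosen lifts `x i ∈ F_{deg i}(R)` of the
`y_i`.  All conditions on `G(R)` are expressed at the filtered level, with
`F_{≺δ}(R) = ⋃_{β ≺ δ} F_β(R)` and `y_i = x_i + F_{≺ deg i}(R)`:
* `span`/`indep` say that the standard monomials `y^γ` (classes of `x^γ` in degree
  `γM = Σ γᵢ·deg i`) form a basis of `G(R)` as a left `Λ`-module;
* `ore_comm` says `y_i·a = σ_i(a)·y_i` for `a ∈ Λ`;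
* `q_comm` says `y_j·y_i = q_{ji}·y_i·y_j` for `i < j`. -/
structure OreGradedFiltration (K : Type*) [CommRing K] (R : Type*) [Ring R] [Algebra K R]
    (n s : ℕ) where
  /-- the admissible order `⪯` on `ℕ^n` -/
  o : AdmOrder n
  /-- the `(ℕ^n,⪯)`-filtration on `R` -/
  F : MIdx n → Submodule K R
  F_mono : ∀ {a b : MIdx n}, o.le a b → F a ≤ F b
  F_mul : ∀ {a b : MIdx n} {u v : R}, u ∈ F a → v ∈ F b → u * v ∈ F (a + b)
  F_exhaustive : ∀ r : R, ∃ a : MIdx n, r ∈ F a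
  F_one : (1 : R) ∈ F 0
  /-- `Λ = F₀(R)`, as a subalgebra of `R` -/
  Λ : Subalgebra K R
  hΛ : Subalgebra.toSubmodule Λ = F 0
  /-- the degrees `α_i` of the homogeneous elements `y_i` -/
  deg : Fin s → MIdx n
  /-- lifts `x_i ∈ F_{α_i}(R)` of the `y_i` -/
  x : Fin s → R
  x_mem : ∀ i, x i ∈ F (deg i)
  /-- the Ore endomorphisms `σ_i` of `Λ` -/
  σ : Fin s → (Λ →+* Λ)
  /-- the commutation scalars `q_{ji} ∈ Λ` -/
  q : Fin s → Fin s → R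
  q_mem : ∀ i j : Fin s, q i j ∈ F 0
  /-- `y_i·a = σ_i(a)·y_i` in `G(R)`, for `a ∈ Λ` -/
  ore_comm : ∀ (i : Fin s) (a : Λ),
    x i * (a : R) - (σ i a : R) * x i ∈ ⨆ β ∈ {β : MIdx n | o.lt β (deg i)}, F β
  /-- `y_j·y_i = q_{ji}·y_i·y_j` in `G(R)`, for `i < j` -/
  q_comm : ∀ i j : Fin s, i < j →
    x j * x i - q j i * (x i * x j) ∈ ⨆ β ∈ {β : MIdx n | o.lt β (deg i + deg j)}, F β
  /-- the monomials `y^γ` span `G(R)` over `Λ` -/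
  span : ∀ δ : MIdx n, ∀ r ∈ F δ, ∃ c : MIdx s →₀ R,
    (∀ γ, c γ ∈ F 0) ∧ (∀ γ ∈ c.support, (∑ i, γ i • deg i) = δ) ∧
    r - (c.sum fun γ a => a * smon x γ) ∈ ⨆ β ∈ {β : MIdx n | o.lt β δ}, F β
  /-- the monomials `y^γ` are left `Λ`-linearly independent in `G(R)` -/
  indep : ∀ (δ : MIdx n) (c : MIdx s →₀ R),
    (∀ γ, c γ ∈ F 0) → (∀ γ ∈ c.support, (∑ i, γ i • deg i) = δ) →
    (c.sum fun γ a => a * smon x γ) ∈ (⨆ β ∈ {β : MIdx n | o.lt β δ}, F β) → c = 0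

namespace OreGradedFiltration

variable {K : Type*} [CommRing K] {R : Type*} [Ring R] [Algebra K R] {n s : ℕ}

/-- `F_{≺δ}(R) = ⋃_{β ≺ δ} F_β(R)`. -/
def Flt (E : OreGradedFiltration K R n s) (δ : MIdx n) : Submodule K R :=
  ⨆ β ∈ {β : MIdx n | E.o.lt β δ}, E.F β

/-- `γM = γ₁α₁ + ⋯ + γ_sα_s ∈ ℕ^n`. -/
def degM (E : OreGradedFiltration K R n s) (γ : MIdx s) : MIdx n :=
  ∑ i, γ i • E.deg i

end OreGradedFiltration

/-- Gordan's alternative: finitely many integer vectors lying in an additively closed set that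
avoids `0` are simultaneously positive for some rational linear functional. -/
theorem exists_functional_pos {n : ℕ} (P : (Fin n → ℤ) → Prop)
    (hadd : ∀ a b, P a → P b → P (a + b)) (h0 : ¬ P 0) (S : Finset (Fin n → ℤ))
    (hS : ∀ v ∈ S, P v) : ∃ u : Fin n → ℚ, ∀ v ∈ S, 0 < ∑ k, u k * (v k : ℚ) := by
  classical
  induction n with
  | zero =>
    refine ⟨0, fun v hv => (h0 ?_).elim⟩
    rw [Subsingleton.elim 0 v]
    exact hS v hv
  | succ n ih =>
    have hsmul : ∀ (k : ℕ) (a : Fin (n + 1) → ℤ), P a → P (((k : ℤ) + 1) • a) := by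
      intro k a ha
      induction k with
      | zero => simpa using ha
      | succ k ihk =>
        have h := hadd _ _ ihk ha
        rwa [← add_one_zsmul] at h
    have hsmul' : ∀ (k : ℤ) (a : Fin (n + 1) → ℤ), 0 < k → P a → P (k • a) := by
      intro k a hk ha
      have h := hsmul (k - 1).toNat a ha
      rwa [Int.toNat_of_nonneg (by lia), sub_add_cancel] at h
    let comb : (Fin (n + 1) → ℤ) × (Fin (n + 1) → ℤ) → Fin (n + 1) → ℤ :=
      fun p => (-(p.2 0)) • p.1 + (p.1 0) • p.2
    let Sp := S.filter fun v => 0 < v 0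
    let Sn := S.filter fun v => v 0 < 0
    let Sz := S.filter fun v => v 0 = 0
    obtain ⟨u, hu⟩ := ih (fun v => P (Fin.cons 0 v))
      (fun a b ha hb => by
        have h := hadd _ _ ha hb
        have e : (Fin.cons 0 a + Fin.cons 0 b : Fin (n + 1) → ℤ) = Fin.cons 0 (a + b) := by
          ext k
          refine Fin.cases ?_ (fun k => ?_) k <;> simp
        rwa [e] at h)
      (by
        have e : (Fin.cons 0 0 : Fin (n + 1) → ℤ) = 0 := by
          ext k
          refine Fin.cases ?_ (fun k => ?_) k <;> simp
        rwa [e])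
      ((Sz ∪ (Sp ×ˢ Sn).image comb).image Fin.tail)
      (by
        intro v hv
        obtain ⟨t, ht, rfl⟩ := Finset.mem_image.1 hv
        have key : t 0 = 0 ∧ P t := by
          rcases Finset.mem_union.1 ht with ht | ht
          · obtain ⟨h1, h2⟩ := Finset.mem_filter.1 ht
            exact ⟨h2, hS _ h1⟩
          · obtain ⟨⟨a, b⟩, hab, rfl⟩ := Finset.mem_image.1 ht
            obtain ⟨ha, hb⟩ := Finset.mem_product.1 hab
            obtain ⟨ha1, ha2⟩ := Finset.mem_filter.1 ha
            obtain ⟨hb1, hb2⟩ := Finset.mem_filter.1 hb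
            refine ⟨by simp [comb]; ring, hadd _ _ (hsmul' _ _ ?_ (hS _ ha1))
              (hsmul' _ _ ha2 (hS _ hb1))⟩
            simpa using hb2
        have e : (Fin.cons 0 (Fin.tail t) : Fin (n + 1) → ℤ) = t := by
          rw [← key.1, Fin.cons_self_tail]
        rw [e]
        exact key.2)
    let L : (Fin (n + 1) → ℤ) → ℚ := fun v => ∑ k, u k * (v k.succ : ℚ)
    obtain ⟨z, hz1, hz2⟩ := Order.exists_between_finsets
      (Sp.image fun v => -(L v) / (v 0 : ℚ)) (Sn.image fun v => -(L v) / (v 0 : ℚ)) (by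
        intro x hx y hy
        obtain ⟨a, ha, rfl⟩ := Finset.mem_image.1 hx
        obtain ⟨b, hb, rfl⟩ := Finset.mem_image.1 hy
        have h := hu (Fin.tail (comb (a, b))) (Finset.mem_image_of_mem _
          (Finset.mem_union_right _ (Finset.mem_image_of_mem _ (Finset.mk_mem_product ha hb))))
        have e : ∑ k, u k * (Fin.tail (comb (a, b)) k : ℚ) =
            -(b 0 : ℚ) * L a + (a 0 : ℚ) * L b := by
          simp only [L, Finset.mul_sum, ← Finset.sum_add_distrib]
          refine Finset.sum_congr rfl fun k _ => ?_
          simp [comb, Fin.tail]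
          ring
        rw [e] at h
        have ha0 : (0 : ℚ) < a 0 := by exact_mod_cast (Finset.mem_filter.1 ha).2
        have hb0 : (0 : ℚ) < -(b 0 : ℚ) := by
          have := (Finset.mem_filter.1 hb).2
          have : (b 0 : ℚ) < 0 := by exact_mod_cast this
          linarith
        have e2 : -(L b) / (b 0 : ℚ) = L b / (-(b 0 : ℚ)) := by rw [neg_div, div_neg]
        rw [e2, div_lt_div_iff₀ ha0 hb0]
        linarith)
    refine ⟨Fin.cons z u, fun v hv => ?_⟩
    rw [Fin.sum_univ_succ]
    simp only [Fin.cons_zero, Fin.cons_succ]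
    change 0 < z * (v 0 : ℚ) + L v
    rcases lt_trichotomy (v 0) 0 with h | h | h
    · have h1 := hz2 _ (Finset.mem_image_of_mem _ (Finset.mem_filter.2 ⟨hv, h⟩))
      have h' : (v 0 : ℚ) < 0 := by exact_mod_cast h
      rw [lt_div_iff_of_neg h'] at h1
      linarith
    · have h1 := hu (Fin.tail v) (Finset.mem_image_of_mem _
        (Finset.mem_union_left _ (Finset.mem_filter.2 ⟨hv, h⟩)))
      rw [h]
      simpa [L, Fin.tail] using h1
    · have h1 := hz1 _ (Finset.mem_image_of_mem _ (Finset.mem_filter.2 ⟨hv, h⟩))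
      have h' : (0 : ℚ) < v 0 := by exact_mod_cast h
      rw [div_lt_iff₀ h'] at h1
      linarith

namespace AdmOrder

variable {n : ℕ} (o : AdmOrder n)

theorem lt_of_lt_of_le {a b c : MIdx n} (h : o.lt a b) (h' : o.le b c) : o.lt a c :=
  ⟨o.le_trans h.1 h', fun e => h.2 (o.le_antisymm h.1 (e ▸ h'))⟩

theorem lt_of_le_of_lt {a b c : MIdx n} (h : o.le a b) (h' : o.lt b c) : o.lt a c :=
  ⟨o.le_trans h h'.1, fun e => h'.2 (o.le_antisymm h'.1 (e ▸ h))⟩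

theorem add_lt_add {a b c d : MIdx n} (h : o.lt a b) (h' : o.lt c d) :
    o.lt (a + c) (b + d) := by
  refine o.lt_of_lt_of_le (b := b + c) ⟨o.add_right c h.1, fun e => h.2 (add_right_cancel e)⟩ ?_
  rw [add_comm b c, add_comm b d]
  exact o.add_right b h'.1

theorem le_of_pi_le {a b : MIdx n} (h : a ≤ b) : o.le a b := by
  have h1 := o.add_right a (o.zero_le (b - a))
  rwa [zero_add, tsub_add_cancel_of_le h] at h1

/-- An admissible order is a well-order, by Dickson's lemma. -/
theorem wellFounded_lt : WellFounded o.lt := by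
  rw [wellFounded_iff_isEmpty_descending_chain]
  refine ⟨fun ⟨f, hf⟩ => ?_⟩
  have hlt : ∀ i k, o.lt (f (i + k + 1)) (f i) := by
    intro i k
    induction k with
    | zero => exact hf i
    | succ k ih => exact o.lt_of_lt_of_le (hf (i + k + 1)) ih.1
  obtain ⟨i, j, hij, hle⟩ := wellQuasiOrdered_le f
  obtain ⟨k, rfl⟩ := Nat.exists_eq_add_of_lt hij
  exact (hlt i k).2 (o.le_antisymm (hlt i k).1 (o.le_of_pi_le hle))

theorem exists_max_image {ι : Type*} (t : Finset ι) (ht : t.Nonempty) (f : ι → MIdx n) :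
    ∃ a ∈ t, ∀ b ∈ t, o.le (f b) (f a) := by
  induction ht using Finset.Nonempty.cons_induction with
  | singleton a => exact ⟨a, by simp, by simpa using o.le_refl _⟩
  | cons a t hat ht ih =>
    obtain ⟨m, hm, hmax⟩ := ih
    rcases o.le_total (f a) (f m) with h | h
    · refine ⟨m, by simp [hm], fun b hb => ?_⟩
      rcases Finset.mem_cons.1 hb with rfl | hb
      · exact h
      · exact hmax b hb
    · refine ⟨a, by simp, fun b hb => ?_⟩
      rcases Finset.mem_cons.1 hb with rfl | hb
      · exact o.le_refl _
      · exact o.le_trans (hmax b hb) h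

/-- Finitely many strict inequalities for an admissible order are realised by a single integer
linear functional. -/
theorem exists_functional (A : Finset (MIdx n × MIdx n)) (hA : ∀ p ∈ A, o.lt p.1 p.2) :
    ∃ u : Fin n → ℤ, ∀ p ∈ A, ∑ k, u k * (p.1 k : ℤ) < ∑ k, u k * (p.2 k : ℤ) := by
  classical
  obtain ⟨u, hu⟩ := exists_functional_pos
    (fun v => ∃ a b : MIdx n, o.lt a b ∧ v = fun k => (b k : ℤ) - a k)
    (by
      rintro _ _ ⟨a, b, h, rfl⟩ ⟨c, d, h', rfl⟩
      refine ⟨a + c, b + d, o.add_lt_add h h', ?_⟩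
      ext k
      simp
      ring)
    (by
      rintro ⟨a, b, h, e⟩
      refine h.2 (funext fun k => ?_)
      have := congrFun e k
      simp only [Pi.zero_apply] at this
      lia)
    (A.image fun p k => (p.2 k : ℤ) - p.1 k)
    (by
      intro v hv
      obtain ⟨p, hp, rfl⟩ := Finset.mem_image.1 hv
      exact ⟨p.1, p.2, hA p hp, rfl⟩)
  obtain ⟨d, hd⟩ := IsLocalization.exist_integer_multiples_of_finite (nonZeroDivisors ℤ) u
  have hd0 : (d : ℤ) ≠ 0 := nonZeroDivisors.coe_ne_zero d
  choose z hz using hd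
  have hz' : ∀ k, (z k : ℚ) = (d : ℤ) * u k := fun k => by simpa using hz k
  refine ⟨fun k => d * z k, fun p hp => ?_⟩
  have h := hu _ (Finset.mem_image_of_mem _ hp)
  have hdd : (0 : ℚ) < ((d : ℤ) : ℚ) * ((d : ℤ) : ℚ) := by
    have : ((d : ℤ) : ℚ) ≠ 0 := by exact_mod_cast hd0
    exact mul_self_pos.2 this
  have h2 := mul_pos hdd h
  have e : ((d : ℤ) : ℚ) * ((d : ℤ) : ℚ) * ∑ k, u k * (((p.2 k : ℤ) - p.1 k : ℤ) : ℚ) =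
      ((∑ k, d * z k * (p.2 k : ℤ) - ∑ k, d * z k * (p.1 k : ℤ) : ℤ) : ℚ) := by
    push_cast
    rw [Finset.mul_sum, ← Finset.sum_sub_distrib]
    refine Finset.sum_congr rfl fun k _ => ?_
    rw [hz']
    ring
  rw [e] at h2
  have h3 : (0 : ℤ) < ∑ k, d * z k * (p.2 k : ℤ) - ∑ k, d * z k * (p.1 k : ℤ) := by
    exact_mod_cast h2
  linarith

end AdmOrder

theorem smon_zero {R : Type*} [Monoid R] {s : ℕ} (x : Fin s → R) : smon x 0 = 1 := by
  simp [smon]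

theorem mul_smon {R : Type*} [Monoid R] {s : ℕ} (x : Fin s → R) (i : Fin s) (γ : MIdx s)
    (h : ∀ k < i, γ k = 0) : x i * smon x γ = smon x (γ + Pi.single i 1) := by
  induction s with
  | zero => exact i.elim0
  | succ s ih =>
    unfold smon at ih ⊢
    rw [List.ofFn_succ, List.ofFn_succ, List.prod_cons, List.prod_cons]
    refine Fin.cases (fun _ => ?_) (fun i h => ?_) i h
    · rw [← mul_assoc]
      congr 2
      · simp [pow_succ']
    · have h0 : γ 0 = 0 := h 0 (Fin.succ_pos i)
      have h1 := ih (fun k => x k.succ) i (fun k => γ k.succ)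
        (fun k hk => h k.succ (Fin.succ_lt_succ_iff.2 hk))
      simp only [Pi.add_apply, h0, pow_zero, one_mul]
      rw [h1, Pi.single_eq_of_ne (Fin.succ_ne_zero i).symm, zero_add, pow_zero, one_mul]
      congr 2
      ext k
      simp [Pi.single_apply]

/-- A multi-index with a nonzero entry is obtained by raising its first nonzero entry. -/
theorem MIdx.exists_eq_add_single {s : ℕ} (γ : MIdx s) (i : Fin s) (hi : γ i ≠ 0) :
    ∃ (j : Fin s) (γ' : MIdx s), j ≤ i ∧ γ = γ' + Pi.single j 1 ∧ ∀ k < j, γ' k = 0 := by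
  classical
  obtain ⟨j, hj, hmin⟩ := WellFounded.has_min (wellFounded_lt (α := Fin s)) {k | γ k ≠ 0} ⟨i, hi⟩
  refine ⟨j, γ - Pi.single j 1, not_lt.1 fun h => hmin i hi h, ?_, fun k hk => ?_⟩
  · refine (tsub_add_cancel_of_le fun k => ?_).symm
    rw [Pi.single_apply]
    split_ifs with h
    · subst h
      exact Nat.one_le_iff_ne_zero.2 hj
    · exact Nat.zero_le _
  · have : γ k = 0 := by
      by_contra h
      exact hmin k h hk
    simp [this]

theorem MIdx.induction_single {s : ℕ} {P : MIdx s → Prop} (h0 : P 0)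
    (hadd : ∀ (j : Fin s) (γ : MIdx s), (∀ k < j, γ k = 0) → P γ → P (γ + Pi.single j 1))
    (γ : MIdx s) : P γ := by
  classical
  induction hm : ∑ i, γ i generalizing γ with
  | zero =>
    have : γ = 0 := funext fun i => by simpa using (Finset.sum_eq_zero_iff.1 hm) i
    exact this ▸ h0
  | succ m ih =>
    have : ∃ i, γ i ≠ 0 := by
      by_contra! h
      simp [h] at hm
    obtain ⟨i, hi⟩ := this
    obtain ⟨j, γ', -, rfl, hγ'⟩ := γ.exists_eq_add_single i hi
    refine hadd j γ' hγ' (ih γ' ?_)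
    simpa [Finset.sum_add_distrib] using hm

theorem MIdx.weight_add_single {s : ℕ} (w : Fin s → ℕ) (γ : MIdx s) (j : Fin s) :
    ∑ i, w i * (γ + Pi.single j 1 : MIdx s) i = ∑ i, w i * γ i + w j := by
  simp [mul_add, Finset.sum_add_distrib, Pi.single_apply]

theorem MIdx.finite_weight_le {s : ℕ} (w : Fin s → ℕ) (hw : ∀ i, 0 < w i) (N : ℕ) :
    {γ : MIdx s | ∑ i, w i * γ i ≤ N}.Finite := by
  refine (Set.finite_Iic (fun _ => N : MIdx s)).subset fun γ hγ i => ?_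
  have h1 : w i * γ i ≤ ∑ i, w i * γ i :=
    Finset.single_le_sum (f := fun i => w i * γ i) (fun _ _ => Nat.zero_le _) (Finset.mem_univ i)
  exact (Nat.le_mul_of_pos_left _ (hw i)).trans (h1.trans hγ)

namespace OreGradedFiltration

variable {K : Type*} [CommRing K] {R : Type*} [Ring R] [Algebra K R] {n s : ℕ}

/-- The left `Λ`-span of the standard monomials `x^γ` with `γ ∈ A`. -/
def monSpan (E : OreGradedFiltration K R n s) (A : Set (MIdx s)) : Submodule K R :=
  ⨆ γ ∈ A, (E.F 0).map (LinearMap.mulRight K (smon E.x γ))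

variable (E : OreGradedFiltration K R n s)

theorem F_zero_mul {δ : MIdx n} {a r : R} (ha : a ∈ E.F 0) (hr : r ∈ E.F δ) : a * r ∈ E.F δ := by
  simpa using E.F_mul ha hr

theorem monSpan_le {A : Set (MIdx s)} {P : Submodule K R}
    (h : ∀ γ ∈ A, ∀ a ∈ E.F 0, a * smon E.x γ ∈ P) : E.monSpan A ≤ P := by
  refine iSup₂_le fun γ hγ => ?_
  rintro _ ⟨a, ha, rfl⟩
  exact h γ hγ a ha

theorem mul_smon_mem {A : Set (MIdx s)} {γ : MIdx s} (hγ : γ ∈ A) {a : R} (ha : a ∈ E.F 0) :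
    a * smon E.x γ ∈ E.monSpan A :=
  Submodule.mem_iSup_of_mem γ (Submodule.mem_iSup_of_mem hγ ⟨a, ha, rfl⟩)

theorem smon_mem {A : Set (MIdx s)} {γ : MIdx s} (hγ : γ ∈ A) : smon E.x γ ∈ E.monSpan A := by
  simpa using E.mul_smon_mem hγ E.F_one

theorem monSpan_mono {A B : Set (MIdx s)} (h : A ⊆ B) : E.monSpan A ≤ E.monSpan B :=
  E.monSpan_le fun _ hγ _ ha => E.mul_smon_mem (h hγ) ha

theorem mul_mem_monSpan {A : Set (MIdx s)} {a r : R} (ha : a ∈ E.F 0) (hr : r ∈ E.monSpan A) :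
    a * r ∈ E.monSpan A := by
  have h : E.monSpan A ≤ (E.monSpan A).comap (LinearMap.mulLeft K a) :=
    E.monSpan_le fun γ hγ b hb => by
      simpa [mul_assoc] using E.mul_smon_mem hγ (E.F_zero_mul ha hb)
  exact h hr

theorem sum_mem_monSpan {A : Set (MIdx s)} {c : MIdx s →₀ R} (hc : ∀ γ, c γ ∈ E.F 0)
    (hA : ∀ γ ∈ c.support, γ ∈ A) : (c.sum fun γ a => a * smon E.x γ) ∈ E.monSpan A :=
  Submodule.sum_mem _ fun γ hγ => E.mul_smon_mem (hA γ hγ) (hc γ)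

theorem sum_add_smon (c d : MIdx s →₀ R) :
    ((c + d).sum fun γ a => a * smon E.x γ) =
      (c.sum fun γ a => a * smon E.x γ) + d.sum fun γ a => a * smon E.x γ :=
  Finsupp.sum_add_index' (by simp) (by simp [add_mul])

theorem filter_mem {c : MIdx s →₀ R} (hc : ∀ γ, c γ ∈ E.F 0) (p : MIdx s → Prop)
    [DecidablePred p] (γ : MIdx s) : c.filter p γ ∈ E.F 0 := by
  rw [Finsupp.filter_apply]
  split_ifs
  exacts [hc γ, zero_mem _]

theorem exists_sum_of_mem_monSpan {A : Set (MIdx s)} {r : R} (hr : r ∈ E.monSpan A) :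
    ∃ c : MIdx s →₀ R, (∀ γ, c γ ∈ E.F 0) ∧ (∀ γ ∈ c.support, γ ∈ A) ∧
      (c.sum fun γ a => a * smon E.x γ) = r := by
  classical
  let P : Submodule K R :=
    { carrier := {r | ∃ c : MIdx s →₀ R, (∀ γ, c γ ∈ E.F 0) ∧ (∀ γ ∈ c.support, γ ∈ A) ∧
        (c.sum fun γ a => a * smon E.x γ) = r}
      zero_mem' := ⟨0, by simp, by simp, by simp⟩
      add_mem' := by
        rintro _ _ ⟨c, hc, hcA, rfl⟩ ⟨d, hd, hdA, rfl⟩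
        refine ⟨c + d, fun γ => add_mem (hc γ) (hd γ), fun γ hγ => ?_, E.sum_add_smon c d⟩
        rcases Finset.mem_union.1 (Finsupp.support_add hγ) with h | h
        exacts [hcA γ h, hdA γ h]
      smul_mem' := by
        rintro k _ ⟨c, hc, hcA, rfl⟩
        refine ⟨k • c, fun γ => Submodule.smul_mem _ k (hc γ),
          fun γ hγ => hcA γ (Finsupp.support_smul hγ), ?_⟩
        rw [Finsupp.sum_smul_index' (by simp), Finsupp.smul_sum]
        simp }
  have h : E.monSpan A ≤ P := E.monSpan_le fun γ hγ a ha => by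
    refine ⟨Finsupp.single γ a, fun γ' => ?_, fun γ' hγ' => ?_, by simp⟩
    · rw [Finsupp.single_apply]
      split_ifs
      exacts [ha, zero_mem _]
    · rw [Finset.mem_singleton.1 (Finsupp.support_single_subset hγ')]
      exact hγ
  exact h hr

theorem degM_add_single (γ : MIdx s) (j : Fin s) :
    E.degM (γ + Pi.single j 1) = E.deg j + E.degM γ := by
  simp [degM, add_smul, Finset.sum_add_distrib, Pi.single_apply, add_comm]

theorem smon_mem_F (γ : MIdx s) : smon E.x γ ∈ E.F (E.degM γ) := by
  induction γ using MIdx.induction_single with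
  | h0 => simpa [smon_zero, degM] using E.F_one
  | hadd j γ h ih =>
    rw [← mul_smon E.x j γ h, degM_add_single]
    exact E.F_mul (E.x_mem j) ih

theorem F_le_Flt {β δ : MIdx n} (h : E.o.lt β δ) : E.F β ≤ E.Flt δ :=
  le_iSup₂_of_le (f := fun β (_ : β ∈ {β : MIdx n | E.o.lt β δ}) => E.F β) β h le_rfl

theorem F_le_monSpan (δ : MIdx n) : E.F δ ≤ E.monSpan {γ | E.o.le (E.degM γ) δ} := by
  induction δ using E.o.wellFounded_lt.induction with
  | _ δ ih =>
    intro r hr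
    obtain ⟨c, hc, hcδ, hrc⟩ := E.span δ r hr
    have h1 : (c.sum fun γ a => a * smon E.x γ) ∈ E.monSpan {γ | E.o.le (E.degM γ) δ} :=
      E.sum_mem_monSpan hc fun γ hγ => by
        change E.o.le (∑ i, γ i • E.deg i) δ
        rw [hcδ γ hγ]
        exact E.o.le_refl δ
    have h2 : E.Flt δ ≤ E.monSpan {γ | E.o.le (E.degM γ) δ} :=
      iSup₂_le fun β hβ => (ih β hβ).trans
        (E.monSpan_mono fun γ hγ => (E.o.lt_of_le_of_lt hγ hβ).1)
    simpa using add_mem (h2 hrc) h1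

theorem Flt_le_monSpan (δ : MIdx n) : E.Flt δ ≤ E.monSpan {γ | E.o.lt (E.degM γ) δ} :=
  iSup₂_le fun β hβ => (E.F_le_monSpan β).trans
    (E.monSpan_mono fun _ hγ => E.o.lt_of_le_of_lt hγ hβ)

/-- The standard monomials are left `Λ`-linearly independent in `R`. -/
theorem eq_zero_of_sum_eq_zero {c : MIdx s →₀ R} (hc : ∀ γ, c γ ∈ E.F 0)
    (h : (c.sum fun γ a => a * smon E.x γ) = 0) : c = 0 := by
  classical
  by_contra hne
  obtain ⟨m, hm, hmax⟩ := E.o.exists_max_image c.support (Finsupp.support_nonempty_iff.2 hne) E.degM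
  have hsplit := E.sum_add_smon (c.filter fun γ => E.degM γ = E.degM m)
    (c.filter fun γ => ¬ E.degM γ = E.degM m)
  rw [Finsupp.filter_add_filter_not, h] at hsplit
  have hlow : ((c.filter fun γ => ¬ E.degM γ = E.degM m).sum fun γ a => a * smon E.x γ) ∈
      E.Flt (E.degM m) := by
    refine Submodule.sum_mem _ fun γ hγ => ?_
    rw [Finsupp.support_filter, Finset.mem_filter] at hγ
    exact E.F_le_Flt ⟨hmax γ hγ.1, hγ.2⟩ (E.F_zero_mul (E.filter_mem hc _ γ) (E.smon_mem_F γ))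
  have htop := E.indep (E.degM m) (c.filter fun γ => E.degM γ = E.degM m) (E.filter_mem hc _)
    (fun γ hγ => by
      rw [Finsupp.support_filter, Finset.mem_filter] at hγ
      exact hγ.2)
    (by
      rw [eq_neg_of_add_eq_zero_left hsplit.symm]
      exact neg_mem hlow)
  have := DFunLike.congr_fun htop m
  rw [Finsupp.filter_apply_pos (fun γ => E.degM γ = E.degM m) c rfl] at this
  exact Finsupp.mem_support_iff.1 hm this

theorem sum_injective {c d : MIdx s →₀ R} (hc : ∀ γ, c γ ∈ E.F 0) (hd : ∀ γ, d γ ∈ E.F 0)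
    (h : (c.sum fun γ a => a * smon E.x γ) = d.sum fun γ a => a * smon E.x γ) : c = d := by
  have h1 := E.sum_add_smon (c - d) d
  rw [sub_add_cancel, h] at h1
  exact sub_eq_zero.1 (E.eq_zero_of_sum_eq_zero (fun γ => sub_mem (hc γ) (hd γ))
    (by simpa using h1.symm))

theorem mem_of_smon_mem_monSpan [Nontrivial R] {A : Set (MIdx s)} {γ : MIdx s}
    (h : smon E.x γ ∈ E.monSpan A) : γ ∈ A := by
  classical
  obtain ⟨c, hc, hcA, hcs⟩ := E.exists_sum_of_mem_monSpan h
  have h1 : c = Finsupp.single γ 1 := E.sum_injective hc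
    (fun γ' => by
      rw [Finsupp.single_apply]
      split_ifs
      exacts [E.F_one, zero_mem _])
    (by simpa using hcs)
  exact hcA γ (by simp [h1])

theorem finite_degM_le [Nontrivial R] (α : MIdx n)
    (hFG : ∃ T : Finset R, (↑T : Set R) ⊆ E.F α ∧
      ∀ r ∈ E.F α, ∃ c : R → R, (∀ t, c t ∈ E.F 0) ∧ r = ∑ t ∈ T, c t * t) :
    {γ | E.o.le (E.degM γ) α}.Finite := by
  classical
  obtain ⟨T, hT, hgen⟩ := hFG
  have hex : ∀ t : T, ∃ A : Finset (MIdx s), (t : R) ∈ E.monSpan A := fun t => by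
    obtain ⟨c, hc, -, hcs⟩ := E.exists_sum_of_mem_monSpan (E.F_le_monSpan α (hT t.2))
    exact ⟨c.support, hcs ▸ E.sum_mem_monSpan hc fun γ hγ => hγ⟩
  choose A hA using hex
  refine (Finset.univ.biUnion A).finite_toSet.subset fun γ hγ => ?_
  obtain ⟨c, hc, hcs⟩ := hgen _ (E.F_mono hγ (E.smon_mem_F γ))
  refine E.mem_of_smon_mem_monSpan ?_
  rw [hcs]
  refine Submodule.sum_mem _ fun t ht => E.mul_mem_monSpan (hc t) (E.monSpan_mono ?_ (hA ⟨t, ht⟩))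
  exact Finset.coe_subset.2 (Finset.subset_biUnion_of_mem A (Finset.mem_univ _))

theorem deg_ne_zero [Nontrivial R] (i : Fin s) : E.deg i ≠ 0 := by
  classical
  intro h
  have hx : E.x i ∈ E.monSpan {0} := by
    have := E.x_mem i
    rw [h] at this
    simpa [smon_zero] using E.mul_smon_mem (Set.mem_singleton (0 : MIdx s)) this
  have e := mul_smon E.x i 0 (by simp)
  rw [smon_zero, mul_one, zero_add] at e
  rw [e] at hx
  have := congrFun (Set.mem_singleton_iff.1 (E.mem_of_smon_mem_monSpan hx)) i
  simp at this

/-- A weight vector for which all the commutation relations have lower-order error terms. -/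
theorem exists_weight
    (hFG : ∀ α : MIdx n, ∃ T : Finset R, (↑T : Set R) ⊆ E.F α ∧
      ∀ r ∈ E.F α, ∃ c : R → R, (∀ t, c t ∈ E.F 0) ∧ r = ∑ t ∈ T, c t * t) :
    ∃ w : Fin s → ℕ, (∀ i, 0 < w i) ∧
      (∀ i, E.Flt (E.deg i) ≤ E.monSpan {γ | ∑ k, w k * γ k < w i}) ∧
      ∀ i j, E.Flt (E.deg i + E.deg j) ≤ E.monSpan {γ | ∑ k, w k * γ k < w i + w j} := by
  classical
  rcases subsingleton_or_nontrivial R with hR | hR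
  · refine ⟨fun _ => 1, fun _ => one_pos, fun i r _ => ?_, fun i j r _ => ?_⟩ <;>
    · rw [Subsingleton.elim r 0]
      exact zero_mem _
  have hfin : ∀ α, {γ | E.o.lt (E.degM γ) α}.Finite := fun α =>
    (E.finite_degM_le α (hFG α)).subset fun γ hγ => hγ.1
  let low : MIdx n → Finset (MIdx n × MIdx n) := fun α =>
    (hfin α).toFinset.image fun γ => (E.degM γ, α)
  obtain ⟨u, hu⟩ := E.o.exists_functional
    ((Finset.univ.image fun i => (0, E.deg i)) ∪ (Finset.univ.biUnion fun i => low (E.deg i)) ∪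
      Finset.univ.biUnion fun p : Fin s × Fin s => low (E.deg p.1 + E.deg p.2))
    (by
      have hlow : ∀ α, ∀ p ∈ low α, E.o.lt p.1 p.2 := fun α p hp => by
        obtain ⟨γ, hγ, rfl⟩ := Finset.mem_image.1 hp
        exact (hfin α).mem_toFinset.1 hγ
      intro p hp
      rcases Finset.mem_union.1 hp with hp | hp
      · rcases Finset.mem_union.1 hp with hp | hp
        · obtain ⟨i, -, rfl⟩ := Finset.mem_image.1 hp
          exact ⟨E.o.zero_le _, (E.deg_ne_zero i).symm⟩
        · obtain ⟨i, -, hp⟩ := Finset.mem_biUnion.1 hp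
          exact hlow _ p hp
      · obtain ⟨i, -, hp⟩ := Finset.mem_biUnion.1 hp
        exact hlow _ p hp)
  let L : MIdx n → ℤ := fun a => ∑ k, u k * (a k : ℤ)
  have hLadd : ∀ a b, L (a + b) = L a + L b := fun a b => by
    simp [L, mul_add, Finset.sum_add_distrib]
  have hpos : ∀ i, 0 < L (E.deg i) := fun i => by
    have := hu (0, E.deg i) (Finset.mem_union_left _ (Finset.mem_union_left _
      (Finset.mem_image_of_mem _ (Finset.mem_univ i))))
    simpa [L] using this
  let w : Fin s → ℕ := fun i => (L (E.deg i)).toNat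
  have hw : ∀ i, (w i : ℤ) = L (E.deg i) := fun i => Int.toNat_of_nonneg (hpos i).le
  have hL : ∀ γ : MIdx s, ((∑ k, w k * γ k : ℕ) : ℤ) = L (E.degM γ) := fun γ => by
    induction γ using MIdx.induction_single with
    | h0 => simp [L, degM]
    | hadd j γ h ih =>
      rw [MIdx.weight_add_single, degM_add_single, hLadd, Nat.cast_add, ih, hw, add_comm]
  refine ⟨w, fun i => ?_, fun i => ?_, fun i j => ?_⟩
  · have := hpos i
    rw [← hw] at this
    exact_mod_cast this
  · refine (E.Flt_le_monSpan _).trans (E.monSpan_mono fun γ hγ => ?_)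
    have := hu (E.degM γ, E.deg i) (Finset.mem_union_left _ (Finset.mem_union_right _
      (Finset.mem_biUnion.2 ⟨i, Finset.mem_univ i,
        Finset.mem_image_of_mem _ ((hfin _).mem_toFinset.2 hγ)⟩)))
    change L (E.degM γ) < L (E.deg i) at this
    rw [← hL, ← hw] at this
    exact_mod_cast this
  · refine (E.Flt_le_monSpan _).trans (E.monSpan_mono fun γ hγ => ?_)
    have := hu (E.degM γ, E.deg i + E.deg j) (Finset.mem_union_right _
      (Finset.mem_biUnion.2 ⟨(i, j), Finset.mem_univ _,
        Finset.mem_image_of_mem _ ((hfin _).mem_toFinset.2 hγ)⟩))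
    change L (E.degM γ) < L (E.deg i + E.deg j) at this
    rw [← hL, hLadd, ← hw, ← hw] at this
    exact_mod_cast this

variable {w : Fin s → ℕ}

theorem monSpan_weight_mono {N M : ℕ} (h : N ≤ M) :
    E.monSpan {γ | ∑ k, w k * γ k ≤ N} ≤ E.monSpan {γ | ∑ k, w k * γ k ≤ M} :=
  E.monSpan_mono fun _ hγ => le_trans hγ h

theorem monSpan_weight_lt_le {N M : ℕ} (h : N ≤ M + 1) :
    E.monSpan {γ | ∑ k, w k * γ k < N} ≤ E.monSpan {γ | ∑ k, w k * γ k ≤ M} :=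
  E.monSpan_mono fun _ hγ => Nat.lt_succ_iff.1 (lt_of_lt_of_le hγ h)

/-- If left multiplication by the `x_i` respects weights up to `B`, so does multiplication. -/
theorem mul_mem_weight_of_x_mul {B : ℕ}
    (hx : ∀ i M, M + w i ≤ B → ∀ v ∈ E.monSpan {γ | ∑ k, w k * γ k ≤ M},
      E.x i * v ∈ E.monSpan {γ | ∑ k, w k * γ k ≤ M + w i})
    {N M : ℕ} (hB : N + M ≤ B) {u v : R} (hu : u ∈ E.monSpan {γ | ∑ k, w k * γ k ≤ N})
    (hv : v ∈ E.monSpan {γ | ∑ k, w k * γ k ≤ M}) :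
    u * v ∈ E.monSpan {γ | ∑ k, w k * γ k ≤ N + M} := by
  have key : ∀ γ : MIdx s, ∑ k, w k * γ k + M ≤ B →
      smon E.x γ * v ∈ E.monSpan {ε | ∑ k, w k * ε k ≤ ∑ k, w k * γ k + M} := by
    intro γ
    induction γ using MIdx.induction_single with
    | h0 => simpa [smon_zero] using fun _ => hv
    | hadd j γ h ih =>
      intro hγ
      rw [MIdx.weight_add_single] at hγ ⊢
      rw [← mul_smon E.x j γ h, mul_assoc, add_right_comm]
      exact hx j _ (by lia) _ (ih (by lia))
  have h : E.monSpan {γ | ∑ k, w k * γ k ≤ N} ≤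
      (E.monSpan {γ | ∑ k, w k * γ k ≤ N + M}).comap (LinearMap.mulRight K v) := by
    refine E.monSpan_le fun γ hγ a ha => ?_
    change ∑ k, w k * γ k ≤ N at hγ
    rw [Submodule.mem_comap, LinearMap.mulRight_apply, mul_assoc]
    refine E.mul_mem_monSpan ha (E.monSpan_weight_mono ?_ (key γ (by lia)))
    lia
  exact h hu

theorem x_mul_mem_weight (hw : ∀ i, 0 < w i)
    (hσ : ∀ i, E.Flt (E.deg i) ≤ E.monSpan {γ | ∑ k, w k * γ k < w i})
    (hq : ∀ i j, E.Flt (E.deg i + E.deg j) ≤ E.monSpan {γ | ∑ k, w k * γ k < w i + w j})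
    (N : ℕ) : ∀ i M, M + w i ≤ N → ∀ v ∈ E.monSpan {γ | ∑ k, w k * γ k ≤ M},
      E.x i * v ∈ E.monSpan {γ | ∑ k, w k * γ k ≤ M + w i} := by
  induction N using Nat.strong_induction_on with
  | _ N ihN =>
  have hmul : ∀ {A B C : ℕ}, A + B ≤ C → 0 < A → C ≤ N → ∀ {u v : R},
      u ∈ E.monSpan {γ | ∑ k, w k * γ k < A} → v ∈ E.monSpan {γ | ∑ k, w k * γ k ≤ B} →
      u * v ∈ E.monSpan {γ | ∑ k, w k * γ k ≤ C} := by
    intro A B C hC hA hN u v hu hv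
    have h1 := E.mul_mem_weight_of_x_mul (B := N - 1) (ihN (N - 1) (by lia))
      (N := A - 1) (M := B) (by lia)
      (E.monSpan_weight_lt_le (by lia) hu) hv
    exact E.monSpan_weight_mono (by lia) h1
  intro i
  induction i using WellFoundedLT.induction with
  | _ i ihi =>
  intro M hM v hv
  have key : E.monSpan {γ | ∑ k, w k * γ k ≤ M} ≤
      (E.monSpan {γ | ∑ k, w k * γ k ≤ M + w i}).comap (LinearMap.mulLeft K (E.x i)) := by
    refine E.monSpan_le fun γ hγ a ha => ?_
    have hγ' : ∑ k, w k * γ k ≤ M := hγ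
    rw [Submodule.mem_comap, LinearMap.mulLeft_apply]
    have haΛ : a ∈ E.Λ := by
      rw [← E.hΛ] at ha
      exact ha
    have hσa : ((E.σ i ⟨a, haΛ⟩ : E.Λ) : R) ∈ E.F 0 := by
      rw [← E.hΛ]
      exact (E.σ i ⟨a, haΛ⟩).2
    have e : E.x i * (a * smon E.x γ) =
        (E.x i * a - (E.σ i ⟨a, haΛ⟩ : R) * E.x i) * smon E.x γ +
          (E.σ i ⟨a, haΛ⟩ : R) * (E.x i * smon E.x γ) := by
      noncomm_ring
    rw [e]
    refine add_mem (hmul (A := w i) (by lia) (hw i) hM (hσ i (E.ore_comm i ⟨a, haΛ⟩))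
      (E.smon_mem hγ)) (E.mul_mem_monSpan hσa ?_)
    by_cases h0 : ∀ k < i, γ k = 0
    · rw [mul_smon E.x i γ h0]
      refine E.smon_mem ?_
      change ∑ k, w k * (γ + Pi.single i 1 : MIdx s) k ≤ M + w i
      rw [MIdx.weight_add_single]
      lia
    · push Not at h0
      obtain ⟨k, hki, hk⟩ := h0
      obtain ⟨j, γ', hjk, rfl, hγ0⟩ := γ.exists_eq_add_single k hk
      have hji : j < i := lt_of_le_of_lt hjk hki
      rw [MIdx.weight_add_single] at hγ'
      rw [← mul_smon E.x j γ' hγ0]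
      have e : E.x i * (E.x j * smon E.x γ') =
          (E.x i * E.x j - E.q i j * (E.x j * E.x i)) * smon E.x γ' +
            E.q i j * (E.x j * (E.x i * smon E.x γ')) := by
        noncomm_ring
      rw [e]
      have hj := hw j
      have hi := hw i
      refine add_mem (hmul (A := w j + w i) (B := ∑ k, w k * γ' k) (by lia) (by lia) hM
        (hq j i (E.q_comm j i hji)) (E.smon_mem (γ := γ') (Nat.le_refl _))) (E.mul_mem_monSpan (E.q_mem i j) ?_)
      have h1 := ihN (∑ k, w k * γ' k + w i) (by lia) i _ le_rfl _
        (E.smon_mem (γ := γ') (Nat.le_refl _))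
      exact E.monSpan_weight_mono (by lia) (ihi j hji _ (by lia) _ h1)
  exact key hv

theorem mul_mem_weight (hw : ∀ i, 0 < w i)
    (hσ : ∀ i, E.Flt (E.deg i) ≤ E.monSpan {γ | ∑ k, w k * γ k < w i})
    (hq : ∀ i j, E.Flt (E.deg i + E.deg j) ≤ E.monSpan {γ | ∑ k, w k * γ k < w i + w j})
    {N M : ℕ} {u v : R} (hu : u ∈ E.monSpan {γ | ∑ k, w k * γ k ≤ N})
    (hv : v ∈ E.monSpan {γ | ∑ k, w k * γ k ≤ M}) :
    u * v ∈ E.monSpan {γ | ∑ k, w k * γ k ≤ N + M} :=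
  E.mul_mem_weight_of_x_mul (E.x_mul_mem_weight hw hσ hq (N + M)) le_rfl hu hv

theorem exists_finset_generators {A : Set (MIdx s)} (hA : A.Finite) :
    ∃ T : Finset R, (↑T : Set R) ⊆ E.monSpan A ∧
      ∀ r ∈ E.monSpan A, ∃ c : R → R, (∀ t, c t ∈ E.F 0) ∧ r = ∑ t ∈ T, c t * t := by
  classical
  refine ⟨hA.toFinset.image (smon E.x), fun t ht => ?_, fun r hr => ?_⟩
  · obtain ⟨γ, hγ, rfl⟩ := Finset.mem_image.1 ht
    exact E.smon_mem (hA.mem_toFinset.1 hγ)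
  · obtain ⟨c, hc, hcA, rfl⟩ := E.exists_sum_of_mem_monSpan hr
    refine ⟨fun t => ∑ γ ∈ hA.toFinset with smon E.x γ = t, c γ,
      fun t => Submodule.sum_mem _ fun γ _ => hc γ, ?_⟩
    rw [Finsupp.sum_of_support_subset c (s := hA.toFinset)
      (fun γ hγ => hA.mem_toFinset.2 (hcA γ hγ)) _ (by simp),
      ← Finset.sum_fiberwise_of_maps_to (fun γ hγ => Finset.mem_image_of_mem (smon E.x) hγ)]
    refine Finset.sum_congr rfl fun t _ => ?_
    rw [Finset.sum_mul]
    refine Finset.sum_congr rfl fun γ hγ => ?_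
    rw [(Finset.mem_filter.1 hγ).2]

theorem exists_leading_form {N : ℕ} {r : R}
    (hr : r ∈ E.monSpan {γ | ∑ k, w k * γ k ≤ N}) :
    ∃ c : MIdx s →₀ R, (∀ γ, c γ ∈ E.F 0) ∧ (∀ γ ∈ c.support, ∑ i, w i * γ i = N) ∧
      r - (c.sum fun γ a => a * smon E.x γ) ∈ E.monSpan {γ | ∑ k, w k * γ k < N} := by
  classical
  obtain ⟨c, hc, hcA, rfl⟩ := E.exists_sum_of_mem_monSpan hr
  refine ⟨c.filter fun γ => ∑ k, w k * γ k = N, E.filter_mem hc _, fun γ hγ => ?_, ?_⟩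
  · rw [Finsupp.support_filter, Finset.mem_filter] at hγ
    exact hγ.2
  · have hsplit := E.sum_add_smon (c.filter fun γ => ∑ k, w k * γ k = N)
      (c.filter fun γ => ¬ ∑ k, w k * γ k = N)
    rw [Finsupp.filter_add_filter_not] at hsplit
    rw [hsplit, add_sub_cancel_left]
    refine E.sum_mem_monSpan (E.filter_mem hc _) fun γ hγ => ?_
    rw [Finsupp.support_filter, Finset.mem_filter] at hγ
    exact lt_of_le_of_ne (hcA γ hγ.1) hγ.2

theorem eq_zero_of_sum_mem_monSpan {A : Set (MIdx s)} {c : MIdx s →₀ R}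
    (hc : ∀ γ, c γ ∈ E.F 0) (hA : ∀ γ ∈ c.support, γ ∉ A)
    (h : (c.sum fun γ a => a * smon E.x γ) ∈ E.monSpan A) : c = 0 := by
  obtain ⟨d, hd, hdA, hds⟩ := E.exists_sum_of_mem_monSpan h
  obtain rfl := E.sum_injective hd hc hds
  by_contra hne
  obtain ⟨γ, hγ⟩ := Finsupp.support_nonempty_iff.2 hne
  exact hA γ hγ (hdA γ hγ)

theorem monSpan_weight_zero (hw : ∀ i, 0 < w i) :
    E.monSpan {γ | ∑ k, w k * γ k ≤ 0} = Subalgebra.toSubmodule E.Λ := by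
  rw [E.hΛ]
  refine le_antisymm (E.monSpan_le fun γ hγ a ha => ?_) fun a ha => ?_
  · have h0 : γ = 0 := funext fun i => by
      have h := Finset.sum_eq_zero_iff.1 (Nat.le_zero.1 hγ) i (Finset.mem_univ i)
      exact (Nat.mul_eq_zero.1 h).resolve_left (hw i).ne'
    simpa [h0, smon_zero] using ha
  · have h0 : (0 : MIdx s) ∈ {γ : MIdx s | ∑ k, w k * γ k ≤ 0} := by simp
    simpa [smon_zero] using E.mul_smon_mem h0 ha

theorem exists_mem_monSpan_weight (w : Fin s → ℕ) (r : R) :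
    ∃ N : ℕ, r ∈ E.monSpan {γ | ∑ k, w k * γ k ≤ N} := by
  obtain ⟨α, hα⟩ := E.F_exhaustive r
  obtain ⟨c, hc, -, rfl⟩ := E.exists_sum_of_mem_monSpan (E.F_le_monSpan α hα)
  exact ⟨c.support.sup fun γ => ∑ k, w k * γ k, E.sum_mem_monSpan hc fun γ hγ =>
    Finset.le_sup (f := fun γ : MIdx s => ∑ k, w k * γ k) hγ⟩

end OreGradedFiltration

/-- **Re-filtration Theorem.** Let `R` carry an `(ℕ^n,⪯)`-filtration `F` whose associated
graded algebra is an iterated Ore extension `Λ[y₁;σ₁]⋯[y_s;σ_s]` over `Λ = F₀(R)` on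
homogeneous elements `y_i` of degree `α_i`, with `y_j·y_i = q_{ji}·y_i·y_j`; assume `Λ` is
left noetherian and each `F_α(R)` is a finitely generated left `Λ`-module, and choose lifts
`x_i ∈ F_{α_i}(R)`.  Then there is a weight vector `w ∈ ℕ^s` with all `w_i > 0` such that
the submodules `R_N = Σ_{⟨w,γ⟩ ≤ N} Λx^γ` form an `ℕ`-filtration of `R` with: (1)
`R_0 = Λ`; (2) each `R_N` is a finitely generated left `Λ`-module; (3) `R_N` is monotone,
`R_N·R_M ⊆ R_{N+M}`, `⋃ R_N = R`, and the associated graded ring `gr(R) = ⊕ R_N/R_{N−1}`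
is isomorphic to `Λ[y₁;σ₁]⋯[y_s;σ_s]`: it is free as a left `Λ`-module with basis the
classes `x̄^γ = x^γ + R_{⟨w,γ⟩−1}`, and the elements `x̄_i = x_i + R_{w_i−1}` satisfy
`x̄_i·a = σ_i(a)·x̄_i` for `a ∈ Λ` and `x̄_j·x̄_i = q_{ji}·x̄_i·x̄_j` for `i < j`
(here `Rlt N = R_{N-1}`, with `R_{-1} = 0`). -/
theorem oreGraded_refiltration {K : Type*} [CommRing K] {R : Type*} [Ring R]
    [Algebra K R] {n s : ℕ} (E : OreGradedFiltration K R n s)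
    (hNoeth : IsNoetherianRing E.Λ)
    (hFG : ∀ α : MIdx n, ∃ T : Finset R, (↑T : Set R) ⊆ E.F α ∧
      ∀ r ∈ E.F α, ∃ c : R → R, (∀ t, c t ∈ E.F 0) ∧ r = ∑ t ∈ T, c t * t) :
    ∃ w : Fin s → ℕ, (∀ i, 0 < w i) ∧
      ∀ Rn Rlt : ℕ → Submodule K R,
        (Rn = fun N => ⨆ γ ∈ {γ : MIdx s | ∑ i, w i * γ i ≤ N},
          (E.F 0).map (LinearMap.mulRight K (smon E.x γ))) →
        (Rlt = fun N => ⨆ γ ∈ {γ : MIdx s | ∑ i, w i * γ i < N},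
          (E.F 0).map (LinearMap.mulRight K (smon E.x γ))) →
        -- (1) `R_0 = Λ`
        (Rn 0 = Subalgebra.toSubmodule E.Λ) ∧
        -- (2) each `R_N` is a finitely generated left `Λ`-module
        (∀ N : ℕ, ∃ T : Finset R, (↑T : Set R) ⊆ Rn N ∧
          ∀ r ∈ Rn N, ∃ c : R → R, (∀ t, c t ∈ E.F 0) ∧ r = ∑ t ∈ T, c t * t) ∧
        -- (3) the `R_N` form an exhaustive multiplicative `ℕ`-filtration …
        (∀ N M : ℕ, N ≤ M → Rn N ≤ Rn M) ∧
        (∀ N M : ℕ, ∀ u ∈ Rn N, ∀ v ∈ Rn M, u * v ∈ Rn (N + M)) ∧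
        (∀ r : R, ∃ N : ℕ, r ∈ Rn N) ∧
        -- … whose associated graded ring is `Λ[y₁;σ₁]⋯[y_s;σ_s]`:
        -- the classes `x̄^γ` span `gr(R)` over `Λ` …
        (∀ N : ℕ, ∀ r ∈ Rn N, ∃ c : MIdx s →₀ R, (∀ γ, c γ ∈ E.F 0) ∧
          (∀ γ ∈ c.support, ∑ i, w i * γ i = N) ∧
          r - (c.sum fun γ a => a * smon E.x γ) ∈ Rlt N) ∧
        -- … and are left `Λ`-linearly independent in `gr(R)`, …
        (∀ (N : ℕ) (c : MIdx s →₀ R), (∀ γ, c γ ∈ E.F 0) →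
          (∀ γ ∈ c.support, ∑ i, w i * γ i = N) →
          (c.sum fun γ a => a * smon E.x γ) ∈ Rlt N → c = 0) ∧
        -- … with `x̄_i·a = σ_i(a)·x̄_i` for `a ∈ Λ` …
        (∀ (i : Fin s) (a : E.Λ),
          E.x i * (a : R) - (E.σ i a : R) * E.x i ∈ Rlt (w i)) ∧
        -- … and `x̄_j·x̄_i = q_{ji}·x̄_i·x̄_j` for `i < j`
        (∀ i j : Fin s, i < j →
          E.x j * E.x i - E.q j i * (E.x i * E.x j) ∈ Rlt (w i + w j)) := by
  obtain ⟨w, hw, hσ, hq⟩ := E.exists_weight hFG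
  refine ⟨w, hw, ?_⟩
  rintro _ _ rfl rfl
  exact ⟨E.monSpan_weight_zero hw,
    fun N => E.exists_finset_generators (MIdx.finite_weight_le w hw N),
    fun N M h => E.monSpan_weight_mono h,
    fun N M u hu v hv => E.mul_mem_weight hw hσ hq hu hv,
    E.exists_mem_monSpan_weight w,
    fun N r hr => E.exists_leading_form hr,
    fun N c hc hN h => E.eq_zero_of_sum_mem_monSpan hc (fun γ hγ => (hN γ hγ).not_lt) h,
    fun i a => hσ i (E.ore_comm i a),
    fun i j hij => hq i j (E.q_comm i j hij)⟩
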